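/- Let n ≥ 159 and d = 6. For generic f ∈ S^6, the following holds: if T ⊆ S^3 = R_f^3 is a Zariski-closed algebraic subset of dimension ≥ n+1 such that for all A, B ∈ T the class of AB in R_f^6 is a square (AB mod J_f ∈ Sq_f^6), then there exists a nonzero linear form K ∈ S^1 such that T = K·Sq^2 := {K·A² : A ∈ S^1}. -/

import Mathlib

open MvPolynomial

noncomputable section

abbrev S (n : ℕ) : Type := MvPolynomial (Fin (n + 1)) ℂ

/-- The Jacobian ideal of `f`, generated by its partial derivatives. -/
def jacobianIdeal {n : ℕ} (f : S n) : Ideal (S n) :=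
  Ideal.span (Set.range fun i => MvPolynomial.pderiv i f)

/-- The degree-`k` graded piece of `S/I`: the image of the homogeneous degree-`k`
polynomials in the quotient. -/
def quotPiece {n : ℕ} (I : Ideal (S n)) (k : ℕ) : Submodule ℂ (S n ⧸ I) :=
  (MvPolynomial.homogeneousSubmodule (Fin (n + 1)) ℂ k).map
    (Ideal.Quotient.mkₐ ℂ I).toLinearMap

/-- The degree-`k` graded piece `R_f^k` of the Jacobian ring `R_f = S/J_f`. -/
def Rpiece {n : ℕ} (f : S n) (k : ℕ) : Submodule ℂ (S n ⧸ jacobianIdeal f) :=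
  quotPiece (jacobianIdeal f) k

/-- `f` defines a smooth hypersurface: its partial derivatives have no common
zero in `ℂ^{n+1} \ {0}`. -/
def SmoothHyp {n : ℕ} (f : S n) : Prop :=
  ∀ v : Fin (n + 1) → ℂ, (∀ i, MvPolynomial.eval v (MvPolynomial.pderiv i f) = 0) → v = 0

/-- A polynomial function on a complex vector space: an element of the algebra of
functions generated by the linear functionals. -/
def IsPolyFun {M : Type} [AddCommGroup M] [Module ℂ M] (φ : M → ℂ) : Prop :=
  φ ∈ Algebra.adjoin ℂ {ψ : M → ℂ | ∃ l : M →ₗ[ℂ] ℂ, ψ = ⇑l}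

/-- A property `P` holds for generic points of `M`: it holds on a nonempty
Zariski-open subset, i.e. on the nonvanishing locus of some polynomial function
that is not identically zero. -/
def GenericallyHolds {M : Type} [AddCommGroup M] [Module ℂ M] (P : M → Prop) : Prop :=
  ∃ φ : M → ℂ, IsPolyFun φ ∧ (∃ x, φ x ≠ 0) ∧ ∀ x, φ x ≠ 0 → P x

/-- Substitution of the linear change of coordinates given by the matrix `A`. -/
def substLin {n : ℕ} (A : Matrix (Fin (n + 1)) (Fin (n + 1)) ℂ) (f : S n) : S n :=
  MvPolynomial.aeval (fun i => ∑ j, A i j • MvPolynomial.X j) f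

/-- A regular sequence: each `f i` is a nonzerodivisor modulo the previous ones. -/
def IsRegularSeq {n c : ℕ} (f : Fin c → S n) : Prop :=
  ∀ (i : Fin c) (g : S n),
    f i * g ∈ Ideal.span (f '' {j | j < i}) → g ∈ Ideal.span (f '' {j | j < i})

/-- Zariski-closed subset of a complex vector space: common zero locus of a set of
polynomial functions. -/
def IsZariskiClosed {M : Type} [AddCommGroup M] [Module ℂ M] (T : Set M) : Prop :=
  ∃ 𝒮 : Set (M → ℂ), (∀ φ ∈ 𝒮, IsPolyFun φ) ∧ T = {x | ∀ φ ∈ 𝒮, φ x = 0}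

/-- An irreducible Zariski-closed subset. -/
def IsIrredClosed {M : Type} [AddCommGroup M] [Module ℂ M] (Z : Set M) : Prop :=
  IsZariskiClosed Z ∧ Z.Nonempty ∧
    ∀ C₁ C₂ : Set M, IsZariskiClosed C₁ → IsZariskiClosed C₂ →
      Z ⊆ C₁ ∪ C₂ → Z ⊆ C₁ ∨ Z ⊆ C₂

/-- The (Krull) dimension of the algebraic set `T` is at least `m`: there is a strictly
increasing chain of `m+1` irreducible closed subsets contained in `T`. -/
def algDimGE {M : Type} [AddCommGroup M] [Module ℂ M] (T : Set M) (m : ℕ) : Prop :=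
  ∃ Z : Fin (m + 1) → Set M, StrictMono Z ∧ (∀ i, IsIrredClosed (Z i)) ∧
    Z (Fin.last m) ⊆ T

/-- Under an integral extension, a chain of primes lifts to a chain of primes of the same
length; the lift is recorded through heights. -/
theorem exists_prime_over_le_height {R A : Type*} [CommRing R] [CommRing A] [Algebra R A]
    [Algebra.IsIntegral R A] {m s : ℕ} (p : Fin (m + 1) → PrimeSpectrum R) (hp : StrictMono p)
    (J₀ : PrimeSpectrum A) (hJ₀ : J₀.asIdeal.comap (algebraMap R A) = (p 0).asIdeal)
    (hs : (s : ℕ∞) ≤ Order.height J₀) (k : ℕ) (hk : k ≤ m) :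
    ∃ J : PrimeSpectrum A,
      J.asIdeal.comap (algebraMap R A) = (p ⟨k, Nat.lt_succ_of_le hk⟩).asIdeal ∧
        ((s + k : ℕ) : ℕ∞) ≤ Order.height J := by
  induction k with
  | zero => exact ⟨J₀, hJ₀, by simpa using hs⟩
  | succ k ih =>
    obtain ⟨J, hJ, hh⟩ := ih (by omega)
    have hlt : p ⟨k, by omega⟩ < p ⟨k + 1, by omega⟩ := hp (by simp)
    obtain ⟨Q, hQ, hQp, hQc⟩ := Ideal.exists_ideal_over_prime_of_isIntegral
      (p ⟨k + 1, by omega⟩).asIdeal J.asIdeal (hJ.trans_le hlt.le)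
    refine ⟨⟨Q, hQp⟩, hQc, ?_⟩
    have hne : J < ⟨Q, hQp⟩ := by
      refine lt_of_le_of_ne hQ ?_
      rintro rfl
      exact hlt.ne (PrimeSpectrum.ext (hJ.symm.trans hQc))
    calc ((s + (k + 1) : ℕ) : ℕ∞) = (s + k : ℕ) + 1 := by push_cast; ring
      _ ≤ Order.height J + 1 := by gcongr
      _ ≤ _ := Order.height_add_one_le hne

/-- A chain of primes in a subalgebra over which a polynomial ring in `k` variables is integral
has length at most `k`, and a chain of length `k` starts at `⊥`. -/
theorem length_le_and_eq_bot_of_isIntegral {k m : ℕ} (Q : Subalgebra ℂ (MvPolynomial (Fin k) ℂ))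
    [Algebra.IsIntegral Q (MvPolynomial (Fin k) ℂ)]
    (p : Fin (m + 1) → PrimeSpectrum Q) (hp : StrictMono p) :
    m ≤ k ∧ (m = k → (p 0).asIdeal = ⊥) := by
  have hdim (J : PrimeSpectrum (MvPolynomial (Fin k) ℂ)) (t : ℕ)
      (h : (t : ℕ∞) ≤ Order.height J) : t ≤ k := by
    have h1 : ((Order.height J : ℕ∞) : WithBot ℕ∞) ≤ (k : ℕ) :=
      (Order.height_le_krullDim J).trans_eq (by
        change ringKrullDim _ = _
        rw [MvPolynomial.ringKrullDim_of_isNoetherianRing]; simp)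
    have h2 : ((t : ℕ∞) : WithBot ℕ∞) ≤ ((k : ℕ∞) : WithBot ℕ∞) :=
      (WithBot.coe_le_coe.mpr h).trans h1
    exact_mod_cast h2
  obtain ⟨J₀, -, hJp, hJ₀⟩ := Ideal.exists_ideal_over_prime_of_isIntegral (p 0).asIdeal
    (⊥ : Ideal (MvPolynomial (Fin k) ℂ)) (by
      intro x hx
      have : x = 0 := by
        have := hx
        rw [Ideal.mem_comap, Ideal.mem_bot] at this
        exact Subtype.ext this
      simp [this])
  have key (s : ℕ) (hs : (s : ℕ∞) ≤ Order.height (⟨J₀, hJp⟩ : PrimeSpectrum _)) : s + m ≤ k := by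
    obtain ⟨J, -, hJ⟩ := exists_prime_over_le_height p hp ⟨J₀, hJp⟩ hJ₀ hs m le_rfl
    exact hdim J _ hJ
  refine ⟨by simpa using key 0 (by simp), fun hmk => ?_⟩
  by_contra hne
  have h1 : (⊥ : PrimeSpectrum (MvPolynomial (Fin k) ℂ)) < ⟨J₀, hJp⟩ := by
    refine lt_of_le_of_ne bot_le ?_
    intro h
    apply hne
    rw [← hJ₀]
    have h2 : J₀ = ⊥ := (congrArg PrimeSpectrum.asIdeal h).symm
    rw [h2, ← RingHom.ker_eq_comap_bot, (RingHom.injective_iff_ker_eq_bot _).mp]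
    exact Subtype.val_injective
  have h3 := key 1 (by
    have := Order.height_add_one_le h1
    exact le_trans (by simp) this)
  omega

/-- Let `ψ : ℂ^k → M` be a polynomial map through which the squares of the coordinates factor
linearly. A closed set contained in its image has dimension at most `k`, with equality
only for the whole image. -/
theorem dim_le_and_range_subset {M : Type} [AddCommGroup M] [Module ℂ M] {k m : ℕ}
    (ψ : (Fin k → ℂ) → M)
    (hψ : ∀ l : M →ₗ[ℂ] ℂ, ∃ p : MvPolynomial (Fin k) ℂ, ∀ x, l (ψ x) = eval x p)
    (hsq : ∀ i, ∃ l : M →ₗ[ℂ] ℂ, ∀ x, l (ψ x) = x i ^ 2)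
    {T : Set M} (hT : T ⊆ Set.range ψ) (hdim : algDimGE T m) :
    m ≤ k ∧ (m = k → Set.range ψ ⊆ T) := by
  obtain ⟨Z, hZmono, hZ, hZT⟩ := hdim
  have hpoly (φ : M → ℂ) (hφ : IsPolyFun φ) :
      ∃ p : MvPolynomial (Fin k) ℂ, ∀ x, φ (ψ x) = eval x p := by
    induction hφ using Algebra.adjoin_induction with
    | mem φ h => obtain ⟨l, rfl⟩ := h; exact hψ l
    | algebraMap r => exact ⟨C r, fun x => by simp⟩
    | add f g _ _ hf hg =>
      obtain ⟨p, hp⟩ := hf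
      obtain ⟨q, hq⟩ := hg
      exact ⟨p + q, fun x => by simp [hp, hq]⟩
    | mul f g _ _ hf hg =>
      obtain ⟨p, hp⟩ := hf
      obtain ⟨q, hq⟩ := hg
      exact ⟨p * q, fun x => by simp [hp, hq]⟩
  let Q : Subalgebra ℂ (MvPolynomial (Fin k) ℂ) :=
    { carrier := {p | ∃ φ : M → ℂ, IsPolyFun φ ∧ ∀ x, φ (ψ x) = eval x p}
      mul_mem' := by
        rintro p q ⟨φ, hφ, hp⟩ ⟨χ, hχ, hq⟩
        exact ⟨φ * χ, Subalgebra.mul_mem _ hφ hχ, fun x => by simp [hp, hq]⟩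
      add_mem' := by
        rintro p q ⟨φ, hφ, hp⟩ ⟨χ, hχ, hq⟩
        exact ⟨φ + χ, Subalgebra.add_mem _ hφ hχ, fun x => by simp [hp, hq]⟩
      algebraMap_mem' := fun r =>
        ⟨algebraMap ℂ _ r, Subalgebra.algebraMap_mem _ r, fun x => by simp⟩ }
  have hint : Algebra.IsIntegral Q (MvPolynomial (Fin k) ℂ) := by
    have hX (i : Fin k) : IsIntegral Q (X i : MvPolynomial (Fin k) ℂ) := by
      obtain ⟨l, hl⟩ := hsq i
      refine IsIntegral.of_pow (n := 2) (by norm_num) ?_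
      have : (X i ^ 2 : MvPolynomial (Fin k) ℂ) ∈ Q :=
        ⟨l, Algebra.subset_adjoin ⟨l, rfl⟩, fun x => by simp [hl]⟩
      exact isIntegral_algebraMap (R := Q) (x := ⟨_, this⟩)
    refine ⟨fun p => ?_⟩
    induction p using MvPolynomial.induction_on with
    | C a =>
      have : (C a : MvPolynomial (Fin k) ℂ) ∈ Q := Q.algebraMap_mem a
      exact isIntegral_algebraMap (R := Q) (x := ⟨_, this⟩)
    | add p q hp hq => exact hp.add hq
    | mul_X p i hp => exact hp.mul (hX i)
  have hsub (i) : Z i ⊆ Set.range ψ :=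
    ((hZmono.monotone (Fin.le_last i)).trans hZT).trans hT
  let I (i : Fin (m + 1)) : Ideal Q :=
    { carrier := {p | ∀ x, ψ x ∈ Z i → eval x (p : MvPolynomial (Fin k) ℂ) = 0}
      add_mem' := fun {p q} hp hq x hx => by simp [hp x hx, hq x hx]
      zero_mem' := fun x _ => by simp
      smul_mem' := fun c p hp x hx => by simp [hp x hx] }
  have hmem (i) (p : Q) : p ∈ I i ↔ ∀ x, ψ x ∈ Z i → eval x (p : MvPolynomial (Fin k) ℂ) = 0 :=
    Iff.rfl
  have hprime (i) : (I i).IsPrime := by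
    obtain ⟨hcl, ⟨z, hz⟩, hirr⟩ := hZ i
    refine ⟨?_, ?_⟩
    · rw [Ideal.ne_top_iff_one, hmem]
      intro h
      obtain ⟨x, rfl⟩ := hsub i hz
      simpa using h x hz
    · rintro ⟨p, φ, hφ, hp⟩ ⟨q, χ, hχ, hq⟩ hpq
      have := hirr {z | φ z = 0} {z | χ z = 0} ⟨{φ}, by simpa using hφ, by simp⟩
        ⟨{χ}, by simpa using hχ, by simp⟩ (by
          intro z hz
          obtain ⟨x, rfl⟩ := hsub i hz
          have := hpq x hz
          simpa [hp, hq] using this)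
      refine this.imp (fun h x hx => ?_) (fun h x hx => ?_)
      · rw [← hp]; exact h hx
      · rw [← hq]; exact h hx
  have hsep (i) (x) (hx : ψ x ∉ Z i) : ∃ p : Q, p ∈ I i ∧ eval x (p : MvPolynomial _ ℂ) ≠ 0 := by
    obtain ⟨⟨𝒮, h𝒮, hZS⟩, -, -⟩ := hZ i
    rw [hZS] at hx
    simp only [Set.mem_ofPred_eq, not_forall] at hx
    obtain ⟨φ, hφ, hφx⟩ := hx
    obtain ⟨p, hp⟩ := hpoly φ (h𝒮 φ hφ)
    refine ⟨⟨p, φ, h𝒮 φ hφ, hp⟩, fun y hy => ?_, ?_⟩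
    · rw [hZS] at hy
      rw [← hp]; exact hy φ hφ
    · rwa [← hp]
  let P (i : Fin (m + 1)) : PrimeSpectrum Q := ⟨I i.rev, hprime _⟩
  have hP : StrictMono P := by
    intro i j hij
    have hlt : Z j.rev < Z i.rev := hZmono (Fin.rev_lt_rev.mpr hij)
    refine lt_of_le_of_ne (fun p hp x hx => hp x (hlt.le hx)) fun h => ?_
    obtain ⟨z, hz, hz'⟩ := Set.exists_of_ssubset hlt
    obtain ⟨x, rfl⟩ := hsub _ hz
    obtain ⟨p, hp, hpx⟩ := hsep _ x hz'
    have h' : I i.rev = I j.rev := congrArg PrimeSpectrum.asIdeal h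
    rw [← h'] at hp
    exact hpx (hp x hz)
  obtain ⟨h1, h2⟩ := length_le_and_eq_bot_of_isIntegral Q P hP
  refine ⟨h1, fun hmk => ?_⟩
  rintro _ ⟨x, rfl⟩
  apply hZT
  by_contra hx
  obtain ⟨p, hp, hpx⟩ := hsep _ x hx
  have hb : I (Fin.last m) = ⊥ := by simpa [P] using h2 hmk
  rw [hb, Ideal.mem_bot] at hp
  simp [hp] at hpx

theorem homogeneousComponent_add_mul {σ R : Type*} [CommSemiring R] {p q : MvPolynomial σ R}
    {a b : ℕ} (hp : p.totalDegree ≤ a) (hq : q.totalDegree ≤ b) :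
    homogeneousComponent (a + b) (p * q) = homogeneousComponent a p * homogeneousComponent b q := by
  have hs {r : MvPolynomial σ R} {c : ℕ} (hr : r.totalDegree ≤ c) :
      ∑ i ∈ Finset.range (c + 1), homogeneousComponent i r = r := by
    conv_rhs => rw [← sum_homogeneousComponent r]
    refine (Finset.sum_subset (Finset.range_subset_range.mpr (by omega)) fun i _ hi => ?_).symm
    exact homogeneousComponent_eq_zero _ _ (by simpa using hi)
  conv_lhs => rw [← hs hp, ← hs hq]
  rw [Finset.sum_mul_sum, map_sum, Finset.sum_eq_single a]
  · rw [map_sum, Finset.sum_eq_single b]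
    · exact homogeneousComponent_eq_self ((homogeneousComponent_isHomogeneous _ _).mul
        (homogeneousComponent_isHomogeneous _ _))
    · intro j hj hjb
      rw [homogeneousComponent_of_mem ((homogeneousComponent_isHomogeneous _ _).mul
        (homogeneousComponent_isHomogeneous _ _)), if_neg (by omega)]
    · simp
  · intro i hi hia
    rw [map_sum]
    refine Finset.sum_eq_zero fun j hj => ?_
    simp only [Finset.mem_range] at hi hj
    rw [homogeneousComponent_of_mem ((homogeneousComponent_isHomogeneous _ _).mul
      (homogeneousComponent_isHomogeneous _ _)), if_neg (by omega)]
  · simp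

/-- A factorization `A = g * α ^ 2` of a cubic form with `g`, `α` of degree one can be taken
to consist of linear forms, by passing to top-degree parts. -/
theorem eq_top_mul_top_sq {σ : Type*} {A g α : MvPolynomial σ ℂ} (hA : A.IsHomogeneous 3)
    (h : A = g * α ^ 2) (hg : g.totalDegree ≤ 1) (hα : α.totalDegree ≤ 1) :
    A = homogeneousComponent 1 g * homogeneousComponent 1 α ^ 2 := by
  have h2 : (α ^ 2).totalDegree ≤ 1 + 1 := by
    rw [pow_two]
    exact (totalDegree_mul _ _).trans (by omega)
  have h1 := homogeneousComponent_add_mul hg h2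
  rw [← h, pow_two, homogeneousComponent_add_mul hα hα, homogeneousComponent_eq_self hA] at h1
  rw [h1]; ring

theorem totalDegree_mul_sq {σ : Type*} {g α : MvPolynomial σ ℂ} (hg : g ≠ 0) (hα : α ≠ 0) :
    (g * α ^ 2).totalDegree = g.totalDegree + 2 * α.totalDegree := by
  rw [totalDegree_mul_of_isDomain hg (pow_ne_zero _ hα), pow_two,
    totalDegree_mul_of_isDomain hα hα]
  ring

theorem exists_eq_sq_of_associated_sq {σ : Type*} {a d : MvPolynomial σ ℂ}
    (h : Associated (d ^ 2) a) : ∃ e, a = e ^ 2 := by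
  obtain ⟨u, hu⟩ := h
  obtain ⟨r, -, hr⟩ := MvPolynomial.isUnit_iff_eq_C_of_isReduced.mp u.isUnit
  obtain ⟨s, hs⟩ := IsAlgClosed.exists_pow_nat_eq r (n := 2) (by norm_num)
  refine ⟨d * C s, ?_⟩
  rw [← hu, hr, ← hs, map_pow]; ring

/-- Two cubic forms whose product is a square are proportional, or the first one is a linear form
times the square of a linear form. -/
theorem proportional_or_eq_mul_sq {σ : Type*} {A B C' : MvPolynomial σ ℂ}
    (hA : A.IsHomogeneous 3) (hB : B.IsHomogeneous 3) (hA0 : A ≠ 0) (hB0 : B ≠ 0)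
    (h : A * B = C' ^ 2) :
    (∃ c : ℂ, B = c • A) ∨
      ∃ K α : MvPolynomial σ ℂ, K.IsHomogeneous 1 ∧ α.IsHomogeneous 1 ∧ A = K * α ^ 2 := by
  let := UniqueFactorizationMonoid.toGCDMonoid (MvPolynomial σ ℂ)
  obtain ⟨a, b, hAa, hBb, hab⟩ := extract_gcd A B
  set g := gcd A B
  have hg0 : g ≠ 0 := fun h0 => hA0 (by rw [hAa, h0, zero_mul])
  have hgC : g ∣ C' := by
    rw [← UniqueFactorizationMonoid.pow_dvd_pow_iff_dvd (n := 2) (by norm_num), ← h, hAa, hBb]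
    exact ⟨a * b, by ring⟩
  obtain ⟨e, he⟩ := hgC
  have hsq : a * b = e ^ 2 := by
    apply mul_left_cancel₀ (pow_ne_zero 2 hg0)
    calc g ^ 2 * (a * b) = (g * a) * (g * b) := by ring
      _ = C' ^ 2 := by rw [← hAa, ← hBb, h]
      _ = _ := by rw [he]; ring
  obtain ⟨d, hd⟩ := exists_associated_pow_of_mul_eq_pow hab hsq
  obtain ⟨d', hd'⟩ := exists_associated_pow_of_mul_eq_pow (a := b) (b := a)
    ((gcd_comm' a b).isUnit hab) ((mul_comm b a).trans hsq)
  obtain ⟨α, rfl⟩ := exists_eq_sq_of_associated_sq hd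
  obtain ⟨β, rfl⟩ := exists_eq_sq_of_associated_sq hd'
  have hα0 : α ≠ 0 := fun h0 => hA0 (by rw [hAa, h0]; simp)
  have hβ0 : β ≠ 0 := fun h0 => hB0 (by rw [hBb, h0]; simp)
  have hdA := totalDegree_mul_sq hg0 hα0
  have hdB := totalDegree_mul_sq hg0 hβ0
  rw [← hAa, hA.totalDegree hA0] at hdA
  rw [← hBb, hB.totalDegree hB0] at hdB
  by_cases h3 : g.totalDegree = 3
  · left
    have hα := (totalDegree_eq_zero_iff_eq_C (p := α)).mp (by omega)
    have hβ := (totalDegree_eq_zero_iff_eq_C (p := β)).mp (by omega)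
    generalize coeff 0 α = x at hα
    generalize coeff 0 β = y at hβ
    have hx : x ≠ 0 := by rintro rfl; simp [hα] at hα0
    refine ⟨y ^ 2 / x ^ 2, ?_⟩
    rw [hAa, hBb, hα, hβ, smul_eq_C_mul]
    calc g * C y ^ 2 = g * (C (y ^ 2 / x ^ 2 * x ^ 2)) := by
          rw [div_mul_cancel₀ _ (pow_ne_zero 2 hx), map_pow]
      _ = _ := by rw [map_mul, map_pow C x]; ring
  · right
    exact ⟨_, _, homogeneousComponent_isHomogeneous _ _, homogeneousComponent_isHomogeneous _ _,
      eq_top_mul_top_sq hA hAa (by omega) (by omega)⟩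

theorem prime_of_totalDegree_eq_one {σ : Type*} {K : MvPolynomial σ ℂ}
    (hK : K.totalDegree = 1) : Prime K := by
  refine (irreducible_of_totalDegree_eq_one hK fun x hx => ?_).prime
  rw [isUnit_iff_ne_zero]
  rintro rfl
  have : K = 0 := by ext i; simpa using hx i
  simp [this] at hK

theorem eq_mul_sq_of_mul_eq_sq {σ : Type*} {K α B C' : MvPolynomial σ ℂ}
    (hK : K.IsHomogeneous 1) (hB : B.IsHomogeneous 3) (hK0 : K ≠ 0) (hα0 : α ≠ 0)
    (h : K * α ^ 2 * B = C' ^ 2) : ∃ F : MvPolynomial σ ℂ, F.IsHomogeneous 1 ∧ B = K * F ^ 2 := by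
  by_cases hB0 : B = 0
  · exact ⟨0, isHomogeneous_zero _ _ _, by simp [hB0]⟩
  have hαC : α ∣ C' := by
    rw [← UniqueFactorizationMonoid.pow_dvd_pow_iff_dvd (n := 2) (by norm_num), ← h]
    exact ⟨K * B, by ring⟩
  obtain ⟨E, rfl⟩ := hαC
  have h1 : K * B = E ^ 2 := by
    apply mul_left_cancel₀ (pow_ne_zero 2 hα0)
    linear_combination h
  obtain ⟨F, rfl⟩ := (prime_of_totalDegree_eq_one (hK.totalDegree hK0)).dvd_of_dvd_pow
    (Dvd.intro _ h1)
  have h2 : B = K * F ^ 2 := by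
    apply mul_left_cancel₀ hK0
    linear_combination h1
  have hF0 : F ≠ 0 := fun h0 => hB0 (by rw [h2, h0]; simp)
  have hd := totalDegree_mul_sq hK0 hF0
  rw [← h2, hB.totalDegree hB0, hK.totalDegree hK0] at hd
  refine ⟨_, homogeneousComponent_isHomogeneous 1 F, ?_⟩
  conv_rhs => rw [← homogeneousComponent_eq_self hK]
  exact eq_top_mul_top_sq hB h2 (hK.totalDegree_le) (by omega)

/-- A family of cubic forms whose pairwise products are squares is contained in a line or in
the set of multiples `K * x ^ 2` of a fixed linear form `K`. -/
theorem subset_line_or_subset_mul_sq {σ : Type*} (i₀ : σ) {T : Set (MvPolynomial σ ℂ)}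
    (hT : ∀ A ∈ T, A.IsHomogeneous 3) (h : ∀ A ∈ T, ∀ B ∈ T, ∃ C', A * B = C' ^ 2) :
    (∃ A, A.IsHomogeneous 3 ∧ A ≠ 0 ∧ ∀ B ∈ T, ∃ c : ℂ, B = c • A) ∨
      ∃ K : MvPolynomial σ ℂ, K.IsHomogeneous 1 ∧ K ≠ 0 ∧
        ∀ B ∈ T, ∃ x : MvPolynomial σ ℂ, x.IsHomogeneous 1 ∧ B = K * x ^ 2 := by
  by_cases h0 : ∀ A ∈ T, A = 0
  · exact Or.inr ⟨X i₀, isHomogeneous_X _ _, X_ne_zero _, fun B hB =>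
      ⟨0, isHomogeneous_zero _ _ _, by simp [h0 B hB]⟩⟩
  push Not at h0
  obtain ⟨A, hA, hA0⟩ := h0
  by_cases hl : ∀ B ∈ T, ∃ c : ℂ, B = c • A
  · exact Or.inl ⟨A, hT A hA, hA0, hl⟩
  push Not at hl
  obtain ⟨B, hB, hBA⟩ := hl
  obtain ⟨C', hC⟩ := h A hA B hB
  have hB0 : B ≠ 0 := fun h0 => hBA 0 (by simp [h0])
  obtain ⟨c, hc⟩ | ⟨K, α, hK, -, rfl⟩ := proportional_or_eq_mul_sq (hT A hA) (hT B hB) hA0 hB0 hC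
  · exact absurd hc (hBA c)
  refine Or.inr ⟨K, hK, left_ne_zero_of_mul hA0, fun D hD => ?_⟩
  obtain ⟨C'', hC''⟩ := h _ hA D hD
  exact eq_mul_sq_of_mul_eq_sq hK (hT D hD) (left_ne_zero_of_mul hA0)
    (by rintro rfl; simp at hA0) hC''

theorem exists_ne_zero_eval_eq_zero_of_card_lt {q ι : Type} [Fintype q] [Fintype ι]
    (h : Fintype.card q < Fintype.card ι) (F : ι → MvPolynomial q ℂ) :
    ∃ P : MvPolynomial ι ℂ, P ≠ 0 ∧ ∀ x : q → ℂ, eval (fun i => eval x (F i)) P = 0 := by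
  have hF : ¬ AlgebraicIndependent ℂ F := by
    intro hF
    have h1 := hF.cardinalMk_le_trdeg
    rw [MvPolynomial.trdeg_of_isDomain] at h1
    simp only [Cardinal.mk_fintype, Cardinal.lift_natCast, Nat.cast_le] at h1
    omega
  rw [algebraicIndependent_iff] at hF
  push Not at hF
  obtain ⟨P, hP, hP0⟩ := hF
  refine ⟨P, hP0, fun x => ?_⟩
  have := congrArg (eval x) hP
  have hid : (eval x).comp (algebraMap ℂ (MvPolynomial q ℂ)) = RingHom.id ℂ := by ext; simp
  rw [map_zero, aeval_def, eval_eval₂, hid] at this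
  exact this

theorem exists_submatrix_det_ne_zero {K κ ι : Type*} [Field K] [Fintype κ] [Fintype ι]
    (M : Matrix κ ι K) {c : ℕ} (hc : c ≤ M.rank) :
    ∃ (row : Fin c → κ) (col : Fin c → ι), Function.Injective col ∧
      (M.submatrix row col).det ≠ 0 := by
  rw [Matrix.rank_eq_finrank_span_cols] at hc
  obtain ⟨f, hf, -, hli⟩ := Submodule.exists_fun_fin_finrank_span_eq K (Set.range M.col)
  choose col hcol using hf
  let col' : Fin c → ι := col ∘ Fin.castLE hc
  have hli' : LinearIndependent K (M.submatrix id col').col := by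
    have : (M.submatrix id col').col = f ∘ Fin.castLE hc := by
      ext i j
      simp only [Function.comp, ← hcol]
      rfl
    rw [this]
    exact hli.comp _ (Fin.castLE_injective hc)
  have hrk : c = Module.finrank K (Submodule.span K (Set.range (M.submatrix id col').row)) := by
    rw [← Matrix.rank_eq_finrank_span_row, Matrix.rank_eq_finrank_span_cols,
      finrank_span_eq_card hli', Fintype.card_fin]
  obtain ⟨g, hg, -, hgli⟩ := Submodule.exists_fun_fin_finrank_span_eq K
    (Set.range (M.submatrix id col').row)
  choose row hrow using hg
  refine ⟨row ∘ Fin.cast hrk, col', ?_, ?_⟩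
  · intro i j hij
    apply hli'.injective
    ext k
    simp [Matrix.col, hij]
  · rw [← isUnit_iff_ne_zero, ← Matrix.isUnit_iff_isUnit_det,
      ← Matrix.linearIndependent_rows_iff_isUnit]
    have : (M.submatrix (row ∘ Fin.cast hrk) col').row = g ∘ Fin.cast hrk := by
      ext i j
      simp only [Function.comp, ← hrow]
      rfl
    rw [this]
    exact hgli.comp _ (Fin.cast_injective hrk)

theorem exists_poly_vanishing_of_minor {p ι κ : Type} [Fintype p] [Fintype ι] [Fintype κ]
    (M : Matrix κ ι (MvPolynomial p ℂ)) (g : κ → MvPolynomial p ℂ) {c : ℕ}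
    (hc : Fintype.card p + 1 < c) (row : Fin c → κ) (col : Fin c → ι)
    (hcol : Function.Injective col) :
    ∃ P : MvPolynomial ι ℂ, P ≠ 0 ∧ ∀ (a : p → ℂ) (v : ι → ℂ),
      ((M.map (eval a)).submatrix row col).det ≠ 0 →
      (M.map (eval a)).mulVec v = (fun k => eval a (g k)) → eval v P = 0 := by
  classical
  let q := Option (p ⊕ {i : ι // i ∉ Set.range col})
  let φ : MvPolynomial p ℂ →ₐ[ℂ] MvPolynomial q ℂ := rename (some ∘ Sum.inl)
  let w (i : ι) : MvPolynomial q ℂ :=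
    if h : i ∉ Set.range col then X (some (Sum.inr ⟨i, h⟩)) else 0
  let G (k : Fin c) : MvPolynomial q ℂ := X none * ∑ l,
    ((M.map φ).submatrix row col).adjugate k l * (φ (g (row l)) - ∑ j, φ (M (row l) j) * w j)
  let F (i : ι) : MvPolynomial q ℂ := if h : ∃ k, col k = i then G h.choose else w i
  have hcard : Fintype.card q < Fintype.card ι := by
    have h1 : Fintype.card {i : ι // i ∉ Set.range col} = Fintype.card ι - c := by
      rw [Fintype.card_subtype_compl]
      congr 1
      rw [← Nat.card_eq_fintype_card, Nat.card_range_of_injective hcol, Nat.card_fin]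
    have h2 : c ≤ Fintype.card ι := by simpa using Fintype.card_le_of_injective col hcol
    simp only [q, Fintype.card_option, Fintype.card_sum, h1]
    omega
  obtain ⟨P, hP, hPF⟩ := exists_ne_zero_eval_eq_zero_of_card_lt hcard F
  refine ⟨P, hP, fun a v hdet hMv => ?_⟩
  set N := (M.map (eval a)).submatrix row col with hN
  let x : q → ℂ := fun t => t.elim (N.det)⁻¹ (Sum.elim a fun j => v j)
  have hφ (r : MvPolynomial p ℂ) : eval x (φ r) = eval a r := by
    simp only [φ, eval_rename]
    rfl
  have hw (i : ι) : eval x (w i) = if i ∈ Set.range col then 0 else v i := by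
    by_cases h : i ∈ Set.range col
    · simp only [w]
      rw [dif_neg (not_not.mpr h), if_pos h, map_zero]
    · simp only [w, h, not_false_eq_true, dite_true, if_false, eval_X]
      rfl
  have hadj : ((M.map φ).submatrix row col).adjugate.map (eval x) = N.adjugate := by
    have := RingHom.map_adjugate (eval x) ((M.map φ).submatrix row col)
    rw [RingHom.mapMatrix_apply] at this
    rw [this]
    congr 1
    ext i j
    simp [N, hφ]
  have hG (k : Fin c) : eval x (G k) = v (col k) := by
    have h1 : ∀ l, eval a (g (row l)) - ∑ j, eval a (M (row l) j) * eval x (w j)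
        = N.mulVec (v ∘ col) l := by
      intro l
      have h2 := congrFun hMv (row l)
      simp only [Matrix.mulVec, dotProduct, Matrix.map_apply] at h2
      rw [← h2, ← Finset.sum_sub_distrib]
      simp only [Matrix.mulVec, dotProduct, N, Matrix.submatrix_apply, Matrix.map_apply,
        Function.comp]
      rw [← Finset.sum_image (s := Finset.univ) (g := col)
        (f := fun i => eval a (M (row l) i) * v i) (fun _ _ _ _ h => hcol h)]
      rw [← Finset.sum_subset (Finset.subset_univ (Finset.univ.image col))]
      · refine Finset.sum_congr rfl fun i hi => ?_
        have : i ∈ Set.range col := by simpa using hi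
        rw [hw, if_pos this]; ring
      · intro i _ hi
        have : i ∉ Set.range col := by simpa using hi
        rw [hw, if_neg this]; ring
    simp only [G, map_mul, map_sum, map_sub, hφ, eval_X]
    have h3 : ∀ l, eval x (((M.map φ).submatrix row col).adjugate k l) = N.adjugate k l :=
      fun l => congrFun (congrFun hadj k) l
    simp only [h3, h1]
    change (N.det)⁻¹ * (N.adjugate.mulVec (N.mulVec (v ∘ col))) k = _
    rw [Matrix.mulVec_mulVec, Matrix.adjugate_mul, Matrix.smul_mulVec, Matrix.one_mulVec]
    simp [hdet]
  have hF (i : ι) : eval x (F i) = v i := by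
    by_cases h : ∃ k, col k = i
    · simp only [F, h, dite_true]
      rw [hG, h.choose_spec]
    · simp only [F, h, dite_false]
      rw [hw, if_neg (by simpa using h)]
  have := hPF x
  simpa only [hF] using this

/-- Consider linear systems `M(a) v = g(a)` depending polynomially on few parameters `a`, with
`M(a)` of large rank. The vectors `v` solving such a system for some parameter lie in a proper
hypersurface. -/
theorem exists_poly_vanishing_of_rank {p ι κ : Type} [Fintype p] [Fintype ι] [Fintype κ]
    (M : Matrix κ ι (MvPolynomial p ℂ)) (g : κ → MvPolynomial p ℂ) {c : ℕ}
    (hc : Fintype.card p + 1 < c) :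
    ∃ P : MvPolynomial ι ℂ, P ≠ 0 ∧ ∀ (a : p → ℂ) (v : ι → ℂ),
      c ≤ (M.map (eval a)).rank →
      (M.map (eval a)).mulVec v = (fun k => eval a (g k)) → eval v P = 0 := by
  have key (rc : (Fin c → κ) × (Fin c → ι)) : ∃ P : MvPolynomial ι ℂ, P ≠ 0 ∧
      (Function.Injective rc.2 → ∀ (a : p → ℂ) (v : ι → ℂ),
        ((M.map (eval a)).submatrix rc.1 rc.2).det ≠ 0 →
        (M.map (eval a)).mulVec v = (fun k => eval a (g k)) → eval v P = 0) := by
    by_cases h : Function.Injective rc.2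
    · obtain ⟨P, hP0, hP⟩ := exists_poly_vanishing_of_minor M g hc rc.1 rc.2 h
      exact ⟨P, hP0, fun _ => hP⟩
    · exact ⟨1, one_ne_zero, fun h' => absurd h' h⟩
  choose P hP0 hP using key
  have : Fintype ((Fin c → κ) × (Fin c → ι)) := Fintype.ofFinite _
  refine ⟨∏ rc, P rc, Finset.prod_ne_zero_iff.mpr fun rc _ => hP0 rc, fun a v hr hv => ?_⟩
  obtain ⟨row, col, hcol, hdet⟩ := exists_submatrix_det_ne_zero _ hr
  rw [map_prod]
  exact Finset.prod_eq_zero (Finset.mem_univ (row, col)) (hP (row, col) hcol a v hdet hv)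

theorem homogeneousComponent_mul_of_isHomogeneous {σ R : Type*} [CommSemiring R]
    {p q : MvPolynomial σ R} (a : ℕ) {b : ℕ} (hq : q.IsHomogeneous b) :
    homogeneousComponent (a + b) (p * q) = homogeneousComponent a p * q := by
  conv_lhs => rw [← sum_homogeneousComponent p, Finset.sum_mul, map_sum]
  have h (i : ℕ) : homogeneousComponent (a + b) (homogeneousComponent i p * q) =
      if i = a then homogeneousComponent i p * q else 0 := by
    rw [homogeneousComponent_of_mem ((homogeneousComponent_isHomogeneous _ _).mul hq)]
    congr 1
    simp [eq_comm]
  simp only [h, Finset.sum_ite_eq', Finset.mem_range]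
  split_ifs with ha
  · rfl
  · rw [homogeneousComponent_eq_zero _ _ (by omega), zero_mul]

/-- The exponents of the monomials of degree `k` in `N` variables. -/
abbrev MonomialExponent (N k : ℕ) : Type :=
  {s : Fin N →₀ ℕ // s ∈ Finset.finsuppAntidiag (Finset.univ : Finset (Fin N)) k}

namespace MonomialExponent

variable {N k : ℕ}

theorem mem_iff {s : Fin N →₀ ℕ} :
    s ∈ Finset.finsuppAntidiag (Finset.univ : Finset (Fin N)) k ↔ s.degree = k := by
  simp [Finset.mem_finsuppAntidiag, Finsupp.degree_eq_sum]

theorem card_eq (n k : ℕ) : Fintype.card (MonomialExponent (n + 1) k) = (n + k).choose k := by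
  rw [Fintype.card_coe, Finset.card_finsuppAntidiag_nat_eq_choose]
  simp [add_comm]

/-- The homogeneous polynomial with prescribed coefficients. -/
def toPoly {R : Type*} [CommSemiring R] (v : MonomialExponent N k → R) : MvPolynomial (Fin N) R :=
  ∑ s, monomial s.1 (v s)

theorem isHomogeneous_toPoly {R : Type*} [CommSemiring R] (v : MonomialExponent N k → R) :
    (toPoly v).IsHomogeneous k :=
  IsHomogeneous.sum _ _ _ fun s _ => isHomogeneous_monomial _ (mem_iff.mp s.2)

theorem coeff_toPoly {R : Type*} [CommSemiring R] (v : MonomialExponent N k → R)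
    (s : MonomialExponent N k) : coeff s.1 (toPoly v) = v s := by
  classical
  simp only [toPoly, coeff_sum, coeff_monomial]
  rw [Finset.sum_eq_single s]
  · simp
  · intro t _ hts
    exact if_neg fun h => hts (Subtype.ext h)
  · simp

theorem ext_of_isHomogeneous {R : Type*} [CommSemiring R] {p q : MvPolynomial (Fin N) R}
    (hp : p.IsHomogeneous k) (hq : q.IsHomogeneous k)
    (h : ∀ s : MonomialExponent N k, coeff s.1 p = coeff s.1 q) : p = q := by
  ext s
  by_cases hs : s.degree = k
  · exact h ⟨s, mem_iff.mpr hs⟩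
  · rw [hp.coeff_eq_zero hs, hq.coeff_eq_zero hs]

theorem toPoly_coeff {R : Type*} [CommSemiring R] {p : MvPolynomial (Fin N) R}
    (hp : p.IsHomogeneous k) : toPoly (fun s : MonomialExponent N k => coeff s.1 p) = p :=
  ext_of_isHomogeneous (isHomogeneous_toPoly _) hp fun s => coeff_toPoly _ s

theorem map_toPoly {R R' : Type*} [CommSemiring R] [CommSemiring R'] (φ : R →+* R')
    (v : MonomialExponent N k → R) : map φ (toPoly v) = toPoly (φ ∘ v) := by
  simp [toPoly]

end MonomialExponent

/-- The linear vector field with matrix `l`, as a derivation of the polynomial ring. -/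
def linearVectorField {N : ℕ} (l : Fin N × Fin N → ℂ) :
    Derivation ℂ (MvPolynomial (Fin N) ℂ) (MvPolynomial (Fin N) ℂ) :=
  ∑ i, (∑ j, C (l (i, j)) * X j : MvPolynomial (Fin N) ℂ) • pderiv i

namespace linearVectorField

variable {N : ℕ} (l : Fin N × Fin N → ℂ)

theorem apply_eq (p : MvPolynomial (Fin N) ℂ) :
    linearVectorField l p = ∑ i, (∑ j, C (l (i, j)) * X j) * pderiv i p := by
  rw [linearVectorField, ← Derivation.coeFnAddMonoidHom_apply, map_sum, Finset.sum_apply]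
  simp

theorem apply_X (i : Fin N) : linearVectorField l (X i) = ∑ j, C (l (i, j)) * X j := by
  rw [apply_eq, Finset.sum_eq_single i]
  · simp
  · intro j _ hj
    simp [pderiv_X_of_ne hj.symm]
  · simp

theorem isHomogeneous {p : MvPolynomial (Fin N) ℂ} {k : ℕ} (hp : p.IsHomogeneous (k + 1)) :
    (linearVectorField l p).IsHomogeneous (k + 1) := by
  rw [apply_eq]
  refine IsHomogeneous.sum _ _ _ fun i _ => ?_
  rw [add_comm k 1]
  exact (IsHomogeneous.sum _ _ _ fun j _ => isHomogeneous_C_mul_X _ _).mul hp.pderiv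

end linearVectorField

theorem eq_zero_of_derivation_mul_eq_zero {σ : Type*}
    (D : Derivation ℂ (MvPolynomial σ ℂ) (MvPolynomial σ ℂ)) {x h : MvPolynomial σ ℂ}
    (hx : Prime x) (hDx : ¬ x ∣ D x) (hh : D (x * h) = 0) : h = 0 := by
  have key (k : ℕ) : x ^ k ∣ h := by
    induction k with
    | zero => simp
    | succ k ih =>
      obtain ⟨g, rfl⟩ := ih
      have h1 : x ^ k * (((k + 1 : ℕ) : MvPolynomial σ ℂ) * D x * g + x * D g) = 0 := by
        rw [← hh, ← mul_assoc, ← pow_succ', Derivation.leibniz, Derivation.leibniz_pow]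
        simp only [smul_eq_mul, nsmul_eq_mul, Nat.add_sub_cancel]
        ring
      have h2 := (mul_eq_zero.mp h1).resolve_left (pow_ne_zero _ hx.ne_zero)
      have h3 : x ∣ ((k + 1 : ℕ) : MvPolynomial σ ℂ) * D x * g := ⟨-D g, by linear_combination h2⟩
      have hu : IsUnit ((k + 1 : ℕ) : MvPolynomial σ ℂ) := by
        have : ((k + 1 : ℕ) : MvPolynomial σ ℂ) = C ((k + 1 : ℕ) : ℂ) := by simp
        rw [this]
        exact (isUnit_iff_ne_zero.mpr (by exact_mod_cast k.succ_ne_zero)).map C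
      rw [mul_assoc, hu.dvd_mul_left] at h3
      rw [pow_succ]
      exact mul_dvd_mul_left _ ((hx.dvd_or_dvd h3).resolve_left hDx)
  by_contra h0
  obtain ⟨m, hm⟩ := FiniteMultiplicity.of_not_isUnit hx.not_isUnit h0
  exact hm (key _)

/-- A nonzero linear vector field is injective on the multiples of a suitable linear form. -/
theorem exists_linear_form_injective {N : ℕ} {l : Fin N × Fin N → ℂ} (hl : l ≠ 0) (k : ℕ) :
    ∃ x : MvPolynomial (Fin N) ℂ, x.IsHomogeneous 1 ∧ ∀ h : MvPolynomial (Fin N) ℂ,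
      h.IsHomogeneous k → linearVectorField l (x * h) = 0 → h = 0 := by
  by_cases hx : ∃ x : MvPolynomial (Fin N) ℂ, x.IsHomogeneous 1 ∧ x ≠ 0 ∧
      ¬ x ∣ linearVectorField l x
  · obtain ⟨x, hx1, hx0, hxD⟩ := hx
    exact ⟨x, hx1, fun h _ hh => eq_zero_of_derivation_mul_eq_zero _
      (prime_of_totalDegree_eq_one (hx1.totalDegree hx0)) hxD hh⟩
  push Not at hx
  have hoff (i j : Fin N) (hij : i ≠ j) : l (i, j) = 0 := by
    obtain ⟨q, hq⟩ := hx (X i) (isHomogeneous_X _ _) (X_ne_zero _)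
    rw [linearVectorField.apply_X] at hq
    have := congrArg (eval (Pi.single j 1)) hq
    simpa [Pi.single_apply, hij] using this
  have hdX (i : Fin N) : linearVectorField l (X i) = C (l (i, i)) * X i := by
    rw [linearVectorField.apply_X, Finset.sum_eq_single i]
    · intro j _ hj
      simp [hoff i j hj.symm]
    · simp
  have hdiag (i j : Fin N) : l (i, i) = l (j, j) := by
    by_cases hij : i = j
    · rw [hij]
    have hne : (X i + X j : MvPolynomial (Fin N) ℂ) ≠ 0 := by
      intro h
      have := congrArg (eval (Pi.single i 1)) h
      simp [Ne.symm hij] at this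
    obtain ⟨q, hq⟩ := hx (X i + X j) ((isHomogeneous_X _ _).add (isHomogeneous_X _ _)) hne
    rw [map_add, hdX, hdX] at hq
    have := congrArg (eval (Pi.single i 1 - Pi.single j 1)) hq
    simp [hij, Ne.symm hij] at this
    linear_combination this
  obtain ⟨⟨i₀, j₀⟩, h0⟩ := Function.ne_iff.mp hl
  obtain rfl : i₀ = j₀ := by
    by_contra h
    exact h0 (hoff _ _ h)
  refine ⟨X i₀, isHomogeneous_X _ _, fun h hh hD => ?_⟩
  have hE := ((isHomogeneous_X ℂ i₀).mul hh).sum_X_mul_pderiv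
  have h1 : linearVectorField l (X i₀ * h) = C (l (i₀, i₀)) * ((1 + k) • (X i₀ * h)) := by
    rw [← hE, linearVectorField.apply_eq, Finset.mul_sum]
    refine Finset.sum_congr rfl fun i _ => ?_
    rw [← linearVectorField.apply_X, hdX, hdiag i i₀, mul_assoc]
  rw [hD] at h1
  have h2 := (mul_eq_zero.mp h1.symm).resolve_left (by simpa using h0)
  have h3 := (smul_eq_zero.mp h2).resolve_left (by omega)
  exact (mul_eq_zero.mp h3).resolve_left (X_ne_zero _)

open MonomialExponent

/-- The matrix of a linear vector field acting on forms of degree `k`. -/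
def linearVectorField.toMatrix {N : ℕ} (l : Fin N × Fin N → ℂ) (k : ℕ) :
    Matrix (MonomialExponent N k) (MonomialExponent N k) ℂ :=
  fun t s => coeff t.1 (linearVectorField l (monomial s.1 1))

theorem linearVectorField.toMatrix_mulVec {N k : ℕ} (l : Fin N × Fin N → ℂ)
    (v : MonomialExponent N k → ℂ) (t : MonomialExponent N k) :
    (toMatrix l k).mulVec v t = coeff t.1 (linearVectorField l (toPoly v)) := by
  simp only [Matrix.mulVec, dotProduct, toMatrix, toPoly, map_sum, coeff_sum]
  refine Finset.sum_congr rfl fun s _ => ?_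
  have : (monomial s.1 (v s) : MvPolynomial (Fin N) ℂ) = v s • monomial s.1 1 := by
    rw [smul_monomial, smul_eq_mul, mul_one]
  rw [this, Derivation.map_smul, coeff_smul, smul_eq_mul, mul_comm]

theorem linearVectorField.card_le_rank_toMatrix {N : ℕ} {l : Fin N × Fin N → ℂ} (hl : l ≠ 0)
    (k : ℕ) : Fintype.card (MonomialExponent N k) ≤ (toMatrix l (1 + k)).rank := by
  obtain ⟨x, hx, hinj⟩ := exists_linear_form_injective hl k
  let E : (MonomialExponent N k → ℂ) →ₗ[ℂ] (MonomialExponent N (1 + k) → ℂ) :=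
    { toFun := fun v s => coeff s.1 (x * toPoly v)
      map_add' := fun v w => by
        ext s
        simp [toPoly, Finset.sum_add_distrib, mul_add]
      map_smul' := fun c v => by
        ext s
        have : (toPoly (c • v) : MvPolynomial (Fin N) ℂ) = c • toPoly v := by
          simp [toPoly, Finset.smul_sum, smul_monomial]
        simp [this] }
  have hE (v) : toPoly (E v) = x * toPoly v := toPoly_coeff (hx.mul (isHomogeneous_toPoly v))
  have hker : Function.Injective ((toMatrix l (1 + k)).mulVecLin ∘ₗ E) := by
    rw [← LinearMap.ker_eq_bot, LinearMap.ker_eq_bot']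
    intro v hv
    have h0 : linearVectorField l (x * toPoly v) = 0 := by
      refine ext_of_isHomogeneous (k := 1 + k) ?_ (isHomogeneous_zero _ _ _) fun t => ?_
      · have := hx.mul (isHomogeneous_toPoly v)
        rw [add_comm] at this ⊢
        exact linearVectorField.isHomogeneous l this
      · rw [← hE, ← toMatrix_mulVec]
        exact congrFun hv t
    have h1 := hinj _ (isHomogeneous_toPoly v) h0
    ext s
    rw [← coeff_toPoly v s, h1]; simp
  calc Fintype.card (MonomialExponent N k)
      = Module.finrank ℂ (LinearMap.range ((toMatrix l (1 + k)).mulVecLin ∘ₗ E)) := by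
        rw [LinearMap.finrank_range_of_inj hker, Module.finrank_fintype_fun_eq_card]
    _ ≤ (toMatrix l (1 + k)).rank :=
        Submodule.finrank_mono (LinearMap.range_comp_le_range _ _)

/-- For a generic sextic form `f`, no nonzero element `∑ Lᵢ ∂ᵢf` of the degree six part of the
Jacobian ideal has the form `A * B - C ^ 2` with cubic forms `A`, `B`, `C`. -/
theorem exists_poly_vanishing_of_eq_mul_sub_sq {N : ℕ}
    (hN : N * N + 3 * Fintype.card (MonomialExponent N 3) + 1
      < Fintype.card (MonomialExponent N 5)) :
    ∃ P : MvPolynomial (MonomialExponent N 6) ℂ, P ≠ 0 ∧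
      ∀ (l : Fin N × Fin N → ℂ) (f A B C' : MvPolynomial (Fin N) ℂ),
        f.IsHomogeneous 6 → A.IsHomogeneous 3 → B.IsHomogeneous 3 → C'.IsHomogeneous 3 →
        linearVectorField l f = A * B - C' ^ 2 → l ≠ 0 →
        eval (fun s : MonomialExponent N 6 => coeff s.1 f) P = 0 := by
  let p := (Fin N × Fin N) ⊕ (Fin 3 × MonomialExponent N 3)
  have hp : Fintype.card p + 1 < Fintype.card (MonomialExponent N 5) := by
    simpa only [p, Fintype.card_sum, Fintype.card_prod, Fintype.card_fin] using hN
  let M : Matrix (MonomialExponent N 6) (MonomialExponent N 6) (MvPolynomial p ℂ) := fun t s =>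
    ∑ i, ∑ j, X (Sum.inl (i, j)) *
      C (coeff t.1 (X j * pderiv i (monomial s.1 1 : MvPolynomial (Fin N) ℂ)))
  let G (i : Fin 3) : MvPolynomial (Fin N) (MvPolynomial p ℂ) :=
    toPoly fun s : MonomialExponent N 3 => X (Sum.inr (i, s))
  let g (t : MonomialExponent N 6) : MvPolynomial p ℂ := coeff t.1 (G 0 * G 1 - G 2 ^ 2)
  obtain ⟨P, hP0, hP⟩ := exists_poly_vanishing_of_rank M g hp
  refine ⟨P, hP0, fun l f A B C' hf hA hB hC h hl => ?_⟩
  let a : p → ℂ := Sum.elim l fun x => coeff x.2.1 (![A, B, C'] x.1)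
  have hM : M.map (eval a) = linearVectorField.toMatrix l 6 := by
    ext t s
    have hMts : M t s = ∑ i, ∑ j, X (Sum.inl (i, j)) *
      C (coeff t.1 (X j * pderiv i (monomial s.1 1 : MvPolynomial (Fin N) ℂ))) := rfl
    rw [Matrix.map_apply, hMts]
    simp only [linearVectorField.toMatrix, linearVectorField.apply_eq,
      coeff_sum, map_sum, map_mul, eval_X, eval_C, Finset.sum_mul, mul_assoc, coeff_C_mul]
    rfl
  have hG (i : Fin 3) : map (eval a) (G i) = ![A, B, C'] i := by
    have hi : (![A, B, C'] i).IsHomogeneous 3 := by fin_cases i <;> assumption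
    rw [map_toPoly, ← toPoly_coeff hi]
    congr 1
    ext s
    simp [a]
  have hg (t) : eval a (g t) = coeff t.1 (A * B - C' ^ 2) := by
    have := hG 0
    have := hG 1
    have := hG 2
    rw [← coeff_map]
    simp_all
  refine hP a _ ?_ ?_
  · rw [hM]
    exact linearVectorField.card_le_rank_toMatrix hl 5
  · rw [hM]
    ext t
    rw [linearVectorField.toMatrix_mulVec, toPoly_coeff hf, h, hg]

theorem exists_linearVectorField_of_mem_jacobianIdeal {n : ℕ} {f q : S n}
    (hf : f.IsHomogeneous 6) (hq : q.IsHomogeneous 6) (h : q ∈ jacobianIdeal f) :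
    ∃ l, linearVectorField l f = q := by
  obtain ⟨c, hc⟩ := Ideal.mem_span_range_iff_exists_fun.mp h
  have h1 : ∑ i, homogeneousComponent 1 (c i) * pderiv i f = q := by
    conv_rhs => rw [← homogeneousComponent_eq_self hq, ← hc, map_sum]
    exact Finset.sum_congr rfl fun i _ =>
      (homogeneousComponent_mul_of_isHomogeneous 1 (hf.pderiv (i := i))).symm
  have h2 (i) : ∃ d : Fin (n + 1) → ℂ, ∑ j, d j • X j = homogeneousComponent 1 (c i) := by
    rw [← Submodule.mem_span_range_iff_exists_fun, ← homogeneousSubmodule_one_eq_span_X]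
    exact homogeneousComponent_isHomogeneous _ _
  choose d hd using h2
  refine ⟨fun x => d x.1 x.2, ?_⟩
  rw [linearVectorField.apply_eq, ← h1]
  exact Finset.sum_congr rfl fun i _ => by rw [← hd]; simp only [smul_eq_C_mul]

theorem card_bound {n : ℕ} (hn : 159 ≤ n) :
    (n + 1) * (n + 1) + 3 * Fintype.card (MonomialExponent (n + 1) 3) + 1
      < Fintype.card (MonomialExponent (n + 1) 5) := by
  rw [card_eq, card_eq]
  have h3 := Nat.descFactorial_eq_factorial_mul_choose (n + 3) 3
  have h5 := Nat.descFactorial_eq_factorial_mul_choose (n + 5) 5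
  simp only [Nat.descFactorial_succ, Nat.descFactorial_zero, Nat.factorial] at h3 h5
  simp only [show n + 3 - 2 = n + 1 by omega, show n + 3 - 1 = n + 2 by omega,
    show n + 5 - 4 = n + 1 by omega, show n + 5 - 3 = n + 2 by omega,
    show n + 5 - 2 = n + 3 by omega, show n + 5 - 1 = n + 4 by omega, Nat.sub_zero] at h3 h5
  generalize (n + 3).choose 3 = x at *
  generalize (n + 5).choose 5 = y at *
  have h6 : 20 * y = (n + 5) * (n + 4) * x := by
    nlinarith
  have h7 : (n + 1) * (n + 1) + 1 ≤ x := by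
    nlinarith
  nlinarith

theorem isPolyFun_eval {M ι : Type} [AddCommGroup M] [Module ℂ M] (L : ι → M →ₗ[ℂ] ℂ)
    (P : MvPolynomial ι ℂ) : IsPolyFun fun x => eval (fun i => L i x) P := by
  induction P using MvPolynomial.induction_on with
  | C a =>
    simp only [eval_C]
    exact Subalgebra.algebraMap_mem _ a
  | add p q hp hq =>
    simp only [map_add]
    exact Subalgebra.add_mem _ hp hq
  | mul_X p i hp =>
    simp only [map_mul, eval_X]
    exact Subalgebra.mul_mem _ hp (Algebra.subset_adjoin ⟨L i, rfl⟩)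

theorem sum_smul_X_isHomogeneous {n : ℕ} (v : Fin (n + 1) → ℂ) :
    (∑ i, v i • X i : S n).IsHomogeneous 1 :=
  IsHomogeneous.sum _ _ _ fun i _ => by
    rw [smul_eq_C_mul]; exact isHomogeneous_C_mul_X _ _

/-- A closed set of cubic forms contained in a line has dimension at most one. -/
theorem dim_le_one_of_subset_line {n m : ℕ} {A : homogeneousSubmodule (Fin (n + 1)) ℂ 3}
    (hA : A ≠ 0) {T : Set (homogeneousSubmodule (Fin (n + 1)) ℂ 3)}
    (hT : ∀ B ∈ T, ∃ c : ℂ, B = c • A) (hdim : algDimGE T m) : m ≤ 1 := by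
  refine (dim_le_and_range_subset (k := 1) (fun x => x 0 ^ 2 • A) (fun l => ?_) (fun i => ?_)
    (fun B hB => ?_) hdim).1
  · exact ⟨X 0 ^ 2 * C (l A), fun x => by simp⟩
  · obtain ⟨l, hl⟩ := Module.Projective.exists_dual_ne_zero ℂ hA
    refine ⟨(l A)⁻¹ • l, fun x => ?_⟩
    rw [Subsingleton.elim i 0]
    simp only [LinearMap.smul_apply, map_smul, smul_eq_mul]
    field_simp
  · obtain ⟨c, rfl⟩ := hT B hB
    obtain ⟨s, rfl⟩ := IsAlgClosed.exists_pow_nat_eq c (n := 2) (by norm_num)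
    exact ⟨fun _ => s, rfl⟩

/-- A set of cubic forms `K * x ^ 2`, with `K` a fixed linear form, containing closed sets of
dimension at least `n + 1`, contains all of them. -/
theorem eq_of_subset_mul_sq {n : ℕ} {K : S n} (hK : K.IsHomogeneous 1) (hK0 : K ≠ 0)
    {T : Set (homogeneousSubmodule (Fin (n + 1)) ℂ 3)}
    (hT : ∀ B ∈ T, ∃ x : S n, x.IsHomogeneous 1 ∧ (B : S n) = K * x ^ 2)
    (hdim : algDimGE T (n + 1)) :
    T = {A : homogeneousSubmodule (Fin (n + 1)) ℂ 3 |
      ∃ x : S n, x.IsHomogeneous 1 ∧ (A : S n) = K * x ^ 2} := by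
  let lin (v : Fin (n + 1) → ℂ) : S n := ∑ i, v i • X i
  let ψ (v : Fin (n + 1) → ℂ) : homogeneousSubmodule (Fin (n + 1)) ℂ 3 :=
    ⟨K * lin v ^ 2, hK.mul ((sum_smul_X_isHomogeneous v).pow 2)⟩
  have hψ : {A : homogeneousSubmodule (Fin (n + 1)) ℂ 3 |
      ∃ x : S n, x.IsHomogeneous 1 ∧ (A : S n) = K * x ^ 2} = Set.range ψ := by
    ext A
    constructor
    · rintro ⟨x, hx, hA⟩
      have hx' : x ∈ homogeneousSubmodule (Fin (n + 1)) ℂ 1 := hx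
      rw [homogeneousSubmodule_one_eq_span_X, Submodule.mem_span_range_iff_exists_fun] at hx'
      obtain ⟨v, rfl⟩ := hx'
      exact ⟨v, Subtype.ext hA.symm⟩
    · rintro ⟨v, rfl⟩
      exact ⟨lin v, sum_smul_X_isHomogeneous v, rfl⟩
  rw [hψ]
  have hsub : T ⊆ Set.range ψ := by
    rw [← hψ]
    exact hT
  let e (i j : Fin (n + 1)) : homogeneousSubmodule (Fin (n + 1)) ℂ 3 :=
    ⟨K * (X i * X j), hK.mul ((isHomogeneous_X ℂ i).mul (isHomogeneous_X ℂ j))⟩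
  have hexp (v) : ψ v = ∑ i, ∑ j, (v i * v j) • e i j := by
    apply Subtype.ext
    simp only [ψ, lin, e, pow_two, Submodule.coe_sum, Submodule.coe_smul]
    rw [Finset.sum_mul_sum]
    simp only [Finset.mul_sum]
    refine Finset.sum_congr rfl fun i _ => Finset.sum_congr rfl fun j _ => ?_
    rw [smul_mul_smul_comm, mul_smul_comm]
  refine Set.Subset.antisymm hsub ((dim_le_and_range_subset ψ (fun l => ?_) (fun i => ?_)
    hsub hdim).2 rfl)
  · refine ⟨∑ i, ∑ j, X i * X j * C (l (e i j)), fun x => ?_⟩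
    simp [hexp]
  · let mulK : S n →ₗ[ℂ] S n := LinearMap.mulLeft ℂ K
    obtain ⟨r, hr⟩ := mulK.exists_leftInverse_of_injective
      (LinearMap.ker_eq_bot.mpr (mul_right_injective₀ hK0))
    refine ⟨(aeval (Pi.single i (1 : ℂ))).toLinearMap ∘ₗ r ∘ₗ Submodule.subtype _, fun x => ?_⟩
    have h1 : r (K * lin x ^ 2) = lin x ^ 2 := LinearMap.congr_fun hr (lin x ^ 2)
    simp only [LinearMap.comp_apply, Submodule.subtype_apply, ψ, h1]
    simp [lin, Pi.single_apply]

/-- Proposition, degree 6 case.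
For `n ≥ 159` and generic `f ∈ S⁶`: the only Zariski-closed algebraic subsets
`T ⊆ S³ = R_f³` of dimension `≥ n+1` such that `A·B mod J_f` is a square in `R_f⁶`
for all `A, B ∈ T` are the sets `K·Sq² = {K·x² : x ∈ S¹}` for nonzero linear forms `K`. -/
theorem squares_characterization_deg6 (n : ℕ) (hn : 159 ≤ n) :
    GenericallyHolds (fun f : MvPolynomial.homogeneousSubmodule (Fin (n + 1)) ℂ 6 =>
      ∀ T : Set (MvPolynomial.homogeneousSubmodule (Fin (n + 1)) ℂ 3),
        IsZariskiClosed T → algDimGE T (n + 1) →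
        (∀ A ∈ T, ∀ B ∈ T, ∃ C : S n, C.IsHomogeneous 3 ∧
          (A : S n) * (B : S n) - C ^ 2 ∈ jacobianIdeal (f : S n)) →
        ∃ K : S n, K.IsHomogeneous 1 ∧ K ≠ 0 ∧
          T = {A : MvPolynomial.homogeneousSubmodule (Fin (n + 1)) ℂ 3 |
            ∃ x : S n, x.IsHomogeneous 1 ∧ (A : S n) = K * x ^ 2}) := by
  obtain ⟨P, hP0, hP⟩ := exists_poly_vanishing_of_eq_mul_sub_sq (card_bound hn)
  refine ⟨fun f => eval (fun s : MonomialExponent (n + 1) 6 => coeff s.1 (f : S n)) P, ?_, ?_, ?_⟩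
  · exact isPolyFun_eval (fun s : MonomialExponent (n + 1) 6 =>
      lcoeff ℂ s.1 ∘ₗ Submodule.subtype (homogeneousSubmodule (Fin (n + 1)) ℂ 6)) P
  · obtain ⟨v, hv⟩ : ∃ v, eval v P ≠ 0 := by
      by_contra! h
      exact hP0 (funext fun v => by rw [h v, map_zero])
    refine ⟨⟨toPoly v, isHomogeneous_toPoly v⟩, ?_⟩
    simpa only [coeff_toPoly] using hv
  · intro f hf T _ hdim hsq
    have hmul : ∀ A ∈ T, ∀ B ∈ T, ∃ C' : S n, (A : S n) * B = C' ^ 2 := by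
      intro A hA B hB
      obtain ⟨C', hC', hmem⟩ := hsq A hA B hB
      have hA3 : (A : S n).IsHomogeneous 3 := A.2
      have hB3 : (B : S n).IsHomogeneous 3 := B.2
      obtain ⟨l, hl⟩ := exists_linearVectorField_of_mem_jacobianIdeal f.2
        ((hA3.mul hB3).sub (hC'.pow 2)) hmem
      obtain rfl : l = 0 := by
        by_contra h
        exact hf (hP l f A B C' f.2 hA3 hB3 hC' hl h)
      refine ⟨C', sub_eq_zero.mp ?_⟩
      rw [← hl, linearVectorField.apply_eq]
      simp
    rcases subset_line_or_subset_mul_sq (0 : Fin (n + 1)) (T := Subtype.val '' T)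
        (by rintro _ ⟨A, -, rfl⟩; exact A.2)
        (by rintro _ ⟨A, hA, rfl⟩ _ ⟨B, hB, rfl⟩; exact hmul A hA B hB) with
      ⟨A, hA, hA0, hline⟩ | ⟨K, hK, hK0, hsub⟩
    · have := dim_le_one_of_subset_line (A := ⟨A, hA⟩) (fun h => hA0 (congrArg Subtype.val h))
        (fun B hB => (hline B ⟨B, hB, rfl⟩).imp fun c hc => Subtype.ext hc) hdim
      omega
    · exact ⟨K, hK, hK0, eq_of_subset_mul_sq hK hK0 (fun B hB => hsub B ⟨B, hB, rfl⟩) hdim⟩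

end
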